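/- Let L_n be the Laplacian of a strongly connected weighted directed graph with positive left eigenvector h (hᵀL_n = 0, Σ_i h_i = 1). Then the solution y(t) of ẏ = −(L_n ⊗ I_n) y with initial condition y(0) = (I_n^1, …, I_n^n)ᵀ ∈ ℝ^{n²} (the stacked rows of the n×n identity matrix) satisfies lim_{t→∞} y(t) = 1_n ⊗ h; in particular, the diagonal entries satisfy y_i^i(t) → h_i for every i. -/

import Mathlib

open scoped BigOperators Topology

/-- A weighted digraph (adjacency matrix `A`) is strongly connected. -/
def StronglyConnected {n : ℕ} (A : Matrix (Fin n) (Fin n) ℝ) : Prop :=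
  ∀ i j : Fin n, i ≠ j → Relation.TransGen (fun a b => 0 < A a b) i j

/-- `L` is the (in-degree) Laplacian of the weighted digraph with adjacency matrix `A`. -/
def IsLaplacianOf {n : ℕ} (L A : Matrix (Fin n) (Fin n) ℝ) : Prop :=
  (∀ i j, 0 ≤ A i j) ∧ (∀ i, A i i = 0) ∧
    L = Matrix.diagonal (fun i => ∑ k, A i k) - A

/-- The disagreement energy of `x` on the digraph `A`, with node weights `h`. -/
def disagreement {n : ℕ} (A : Matrix (Fin n) (Fin n) ℝ) (h x : Fin n → ℝ) : ℝ :=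
  ∑ i, ∑ k, h i * A i k * (x i - x k) ^ 2

theorem IsLaplacianOf.sum_mul {n : ℕ} {L A : Matrix (Fin n) (Fin n) ℝ} (hL : IsLaplacianOf L A)
    (x : Fin n → ℝ) (i : Fin n) : ∑ k, L i k * x k = ∑ k, A i k * (x i - x k) := by
  simp [hL.2.2, Matrix.sub_apply, Matrix.diagonal_apply, sub_mul, mul_sub,
    Finset.sum_sub_distrib, Finset.sum_mul]

theorem sum_mul_sum_eq_zero {n : ℕ} {L : Matrix (Fin n) (Fin n) ℝ} {h : Fin n → ℝ}
    (hleft : ∀ k, ∑ i, h i * L i k = 0) (x : Fin n → ℝ) :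
    ∑ i, h i * ∑ k, L i k * x k = 0 := by
  simp_rw [Finset.mul_sum]
  rw [Finset.sum_comm]
  simp_rw [← mul_assoc, ← Finset.sum_mul, hleft, zero_mul, Finset.sum_const_zero]

theorem IsLaplacianOf.two_mul_sum_eq_disagreement {n : ℕ} {L A : Matrix (Fin n) (Fin n) ℝ}
    (hL : IsLaplacianOf L A) {h : Fin n → ℝ} (hleft : ∀ k, ∑ i, h i * L i k = 0)
    (x : Fin n → ℝ) :
    ∑ i, h i * (2 * x i * ∑ k, L i k * x k) = disagreement A h x := by
  have hsq := sum_mul_sum_eq_zero hleft fun k => x k ^ 2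
  simp_rw [hL.sum_mul (fun k => x k ^ 2)] at hsq
  simp_rw [hL.sum_mul x]
  rw [← sub_zero (∑ i, _), ← hsq, disagreement, ← Finset.sum_sub_distrib]
  refine Finset.sum_congr rfl fun i _ => ?_
  simp_rw [Finset.mul_sum]
  rw [← Finset.sum_sub_distrib]
  exact Finset.sum_congr rfl fun k _ => by ring

theorem disagreement_sub_const {n : ℕ} (A : Matrix (Fin n) (Fin n) ℝ) (h x : Fin n → ℝ) (c : ℝ) :
    disagreement A h (fun i => x i - c) = disagreement A h x := by
  simp [disagreement]

section Poincare

variable {n : ℕ} {A : Matrix (Fin n) (Fin n) ℝ} {h : Fin n → ℝ}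

theorem disagreement_nonneg (hA : ∀ i j, 0 ≤ A i j) (hpos : ∀ i, 0 < h i) (x : Fin n → ℝ) :
    0 ≤ disagreement A h x :=
  Finset.sum_nonneg fun i _ => Finset.sum_nonneg fun k _ =>
    mul_nonneg (mul_nonneg (hpos i).le (hA i k)) (sq_nonneg _)

theorem mul_sq_sub_le_disagreement (hA : ∀ i j, 0 ≤ A i j) (hpos : ∀ i, 0 < h i)
    (x : Fin n → ℝ) (i k : Fin n) :
    h i * A i k * (x i - x k) ^ 2 ≤ disagreement A h x := by
  have hterm : ∀ i k, 0 ≤ h i * A i k * (x i - x k) ^ 2 := fun i k =>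
    mul_nonneg (mul_nonneg (hpos i).le (hA i k)) (sq_nonneg _)
  exact (Finset.single_le_sum (fun k _ => hterm i k) (Finset.mem_univ k)).trans
    (Finset.single_le_sum (f := fun i => ∑ k, h i * A i k * (x i - x k) ^ 2)
      (fun i _ => Finset.sum_nonneg fun k _ => hterm i k) (Finset.mem_univ i))

theorem exists_sq_sub_le_mul_disagreement_of_adj (hA : ∀ i j, 0 ≤ A i j) (hpos : ∀ i, 0 < h i)
    {i j : Fin n} (hij : 0 < A i j) :
    ∃ C, ∀ x : Fin n → ℝ, (x i - x j) ^ 2 ≤ C * disagreement A h x := by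
  refine ⟨(h i * A i j)⁻¹, fun x => ?_⟩
  rw [← div_eq_inv_mul, le_div_iff₀' (mul_pos (hpos i) hij)]
  exact mul_sq_sub_le_disagreement hA hpos x i j

theorem exists_sq_sub_le_mul_disagreement_of_transGen (hA : ∀ i j, 0 ≤ A i j)
    (hpos : ∀ i, 0 < h i) {i j : Fin n} (hij : Relation.TransGen (fun a b => 0 < A a b) i j) :
    ∃ C, ∀ x : Fin n → ℝ, (x i - x j) ^ 2 ≤ C * disagreement A h x := by
  induction hij with
  | single hadj => exact exists_sq_sub_le_mul_disagreement_of_adj hA hpos hadj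
  | @tail b c _ hadj ih =>
    obtain ⟨C, hC⟩ := ih
    obtain ⟨D, hD⟩ := exists_sq_sub_le_mul_disagreement_of_adj hA hpos hadj
    refine ⟨2 * C + 2 * D, fun x => ?_⟩
    nlinarith [hC x, hD x, sq_nonneg ((x i - x b) - (x b - x c))]

theorem StronglyConnected.exists_sq_sub_le_mul_disagreement (hconn : StronglyConnected A)
    (hA : ∀ i j, 0 ≤ A i j) (hpos : ∀ i, 0 < h i) (i j : Fin n) :
    ∃ C, ∀ x : Fin n → ℝ, (x i - x j) ^ 2 ≤ C * disagreement A h x := by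
  by_cases hij : i = j
  · exact ⟨0, fun x => by simp [hij]⟩
  · exact exists_sq_sub_le_mul_disagreement_of_transGen hA hpos (hconn i j hij)

theorem sum_mul_sum_mul_sq_sub (hsum : ∑ i, h i = 1) {x : Fin n → ℝ}
    (hx : ∑ i, h i * x i = 0) :
    ∑ i, ∑ j, h i * (h j * (x i - x j) ^ 2) = 2 * ∑ i, h i * x i ^ 2 := by
  have hinner (i : Fin n) : ∑ j, h i * (h j * (x i - x j) ^ 2) =
      h i * x i ^ 2 + h i * ∑ j, h j * x j ^ 2 := by
    calc ∑ j, h i * (h j * (x i - x j) ^ 2)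
        = ∑ j, (h i * x i ^ 2 * h j - 2 * h i * x i * (h j * x j) + h i * (h j * x j ^ 2)) :=
          Finset.sum_congr rfl fun j _ => by ring
      _ = _ := by
          rw [Finset.sum_add_distrib, Finset.sum_sub_distrib, ← Finset.mul_sum,
            ← Finset.mul_sum, ← Finset.mul_sum, hsum, hx]
          ring
  simp_rw [hinner]
  rw [Finset.sum_add_distrib, ← Finset.sum_mul, hsum]
  ring

/-- Poincaré inequality on a strongly connected weighted digraph. -/
theorem StronglyConnected.exists_pos_mul_sum_le_disagreement (hconn : StronglyConnected A)
    (hA : ∀ i j, 0 ≤ A i j) (hpos : ∀ i, 0 < h i) (hsum : ∑ i, h i = 1) :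
    ∃ r > 0, ∀ x : Fin n → ℝ, ∑ i, h i * x i = 0 →
      r * ∑ i, h i * x i ^ 2 ≤ disagreement A h x := by
  choose C hC using hconn.exists_sq_sub_le_mul_disagreement hA hpos
  set K := |∑ i, ∑ j, h i * (h j * C i j)| + 1 with hK
  have hKpos : 0 < K := by positivity
  refine ⟨K⁻¹, inv_pos.2 hKpos, fun x hx => ?_⟩
  rw [inv_mul_le_iff₀ hKpos]
  have hW := disagreement_nonneg hA hpos x
  have hV : 0 ≤ ∑ i, h i * x i ^ 2 :=
    Finset.sum_nonneg fun i _ => mul_nonneg (hpos i).le (sq_nonneg _)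
  calc ∑ i, h i * x i ^ 2 ≤ 2 * ∑ i, h i * x i ^ 2 := by linarith
    _ = ∑ i, ∑ j, h i * (h j * (x i - x j) ^ 2) := (sum_mul_sum_mul_sq_sub hsum hx).symm
    _ ≤ ∑ i, ∑ j, h i * (h j * (C i j * disagreement A h x)) :=
        Finset.sum_le_sum fun i _ => Finset.sum_le_sum fun j _ =>
          mul_le_mul_of_nonneg_left
            (mul_le_mul_of_nonneg_left (hC i j x) (hpos j).le) (hpos i).le
    _ = (∑ i, ∑ j, h i * (h j * C i j)) * disagreement A h x := by
        simp_rw [Finset.sum_mul, mul_assoc]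
    _ ≤ K * disagreement A h x :=
        mul_le_mul_of_nonneg_right ((le_abs_self _).trans (by simp [hK])) hW

end Poincare

theorem le_mul_exp_of_hasDerivAt_le {V V' : ℝ → ℝ} {r : ℝ} (hV : ∀ t, HasDerivAt V (V' t) t)
    (hle : ∀ t, V' t ≤ -(r * V t)) {t : ℝ} (ht : 0 ≤ t) :
    V t ≤ V 0 * Real.exp (-(r * t)) := by
  have hd (t : ℝ) : HasDerivAt (fun t => Real.exp (r * t) * V t)
      (Real.exp (r * t) * (r * 1) * V t + Real.exp (r * t) * V' t) t :=
    (((hasDerivAt_id t).const_mul r).exp).mul (hV t)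
  have hanti : Antitone fun t => Real.exp (r * t) * V t := by
    refine antitone_of_hasDerivAt_nonpos hd fun t => ?_
    have := mul_le_mul_of_nonneg_left (hle t) (Real.exp_pos (r * t)).le
    rw [Pi.zero_apply]
    linarith
  have := hanti ht
  simp only [mul_zero, Real.exp_zero, one_mul] at this
  rw [Real.exp_neg, ← div_eq_mul_inv, le_div_iff₀' (Real.exp_pos _)]
  exact this

/-- A solution of `ẋ = −L x` reaches consensus at the conserved `h`-weighted mean. -/
theorem StronglyConnected.tendsto_consensus {n : ℕ} {A L : Matrix (Fin n) (Fin n) ℝ}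
    (hconn : StronglyConnected A) (hLap : IsLaplacianOf L A)
    {h : Fin n → ℝ} (hpos : ∀ i, 0 < h i) (hsum : ∑ i, h i = 1)
    (hleft : ∀ k, ∑ i, h i * L i k = 0) {x : ℝ → Fin n → ℝ}
    (hx : ∀ t i, HasDerivAt (fun t => x t i) (-∑ k, L i k * x t k) t) (i : Fin n) :
    Filter.Tendsto (fun t => x t i) Filter.atTop (𝓝 (∑ j, h j * x 0 j)) := by
  set c := ∑ j, h j * x 0 j with hc
  have hmean (t : ℝ) : ∑ j, h j * x t j = c := by
    have hd (t : ℝ) : HasDerivAt (fun t => ∑ j, h j * x t j) 0 t := by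
      have := HasDerivAt.fun_sum (u := Finset.univ) fun j _ => (hx t j).const_mul (h j)
      simpa [sum_mul_sum_eq_zero hleft] using this
    exact is_const_of_deriv_eq_zero (fun t => (hd t).differentiableAt) (fun t => (hd t).deriv) t 0
  obtain ⟨r, hr, hpoin⟩ := hconn.exists_pos_mul_sum_le_disagreement hLap.1 hpos hsum
  have hV (t : ℝ) : HasDerivAt (fun t => ∑ j, h j * (x t j - c) ^ 2)
      (-disagreement A h (x t)) t := by
    have hd := HasDerivAt.fun_sum (u := Finset.univ) fun j _ =>
      (((hx t j).sub_const c).fun_pow 2).const_mul (h j)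
    refine hd.congr_deriv ?_
    have hzero := sum_mul_sum_eq_zero hleft (x t)
    rw [← hLap.two_mul_sum_eq_disagreement hleft, ← sub_eq_zero, ← Finset.sum_neg_distrib,
      ← Finset.sum_sub_distrib, ← mul_zero (2 * c), ← hzero, Finset.mul_sum]
    exact Finset.sum_congr rfl fun j _ => by push_cast; ring
  have hdecay (t : ℝ) : -disagreement A h (x t) ≤ -(r * ∑ j, h j * (x t j - c) ^ 2) := by
    have hcentered : ∑ j, h j * (x t j - c) = 0 := by
      simp_rw [mul_sub]
      rw [Finset.sum_sub_distrib, ← Finset.sum_mul, hsum, hmean, one_mul, sub_self]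
    have := hpoin _ hcentered
    rw [disagreement_sub_const] at this
    exact neg_le_neg this
  have hexp : Filter.Tendsto (fun t => (h i)⁻¹ * ((∑ j, h j * (x 0 j - c) ^ 2) *
      Real.exp (-(r * t)))) Filter.atTop (𝓝 0) := by
    have := (Real.tendsto_exp_neg_atTop_nhds_zero.comp
      (Filter.tendsto_id.const_mul_atTop hr)).const_mul (∑ j, h j * (x 0 j - c) ^ 2)
    simpa using this.const_mul (h i)⁻¹
  have hsq : Filter.Tendsto (fun t => (x t i - c) ^ 2) Filter.atTop (𝓝 0) := by
    refine squeeze_zero' (Filter.Eventually.of_forall fun t => sq_nonneg _) ?_ hexp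
    filter_upwards [Filter.eventually_ge_atTop 0] with t ht
    rw [← div_eq_inv_mul, le_div_iff₀' (hpos i)]
    exact (Finset.single_le_sum (f := fun j => h j * (x t j - c) ^ 2)
      (fun j _ => mul_nonneg (hpos j).le (sq_nonneg _)) (Finset.mem_univ i)).trans
        (le_mul_exp_of_hasDerivAt_le hV hdecay ht)
  have habs : Filter.Tendsto (fun t => |x t i - c|) Filter.atTop (𝓝 0) := by
    simpa [Real.sqrt_sq_eq_abs] using hsq.sqrt
  exact tendsto_sub_nhds_zero_iff.1 ((tendsto_zero_iff_abs_tendsto_zero _).2 habs)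

/-- The distributed left-eigenvector estimator: the solution of
`ẏ = −(L_n ⊗ I_n) y` with `y(0)` the stacked rows of the identity matrix
converges to `1_n ⊗ h`; in particular `y_i^i(t) → h_i` for every `i`. -/
theorem stmt15 {n : ℕ} (A L : Matrix (Fin n) (Fin n) ℝ)
    (hLap : IsLaplacianOf L A) (hconn : StronglyConnected A)
    (h : Fin n → ℝ) (hpos : ∀ i, 0 < h i) (hsum : ∑ i, h i = 1)
    (hleft : ∀ k, ∑ i, h i * L i k = 0)
    (y : ℝ → Fin n → Fin n → ℝ)
    (hy : ∀ t : ℝ, HasDerivAt y (fun i => -(∑ k, L i k • y t k)) t)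
    (hy0 : y 0 = fun i k => if i = k then (1 : ℝ) else 0) :
    Filter.Tendsto y Filter.atTop (𝓝 (fun _ => h)) ∧
    ∀ i, Filter.Tendsto (fun t => y t i i) Filter.atTop (𝓝 (h i)) := by
  have hentry (i k : Fin n) : Filter.Tendsto (fun t => y t i k) Filter.atTop (𝓝 (h k)) := by
    have hderiv (t : ℝ) (i : Fin n) :
        HasDerivAt (fun t => y t i k) (-∑ j, L i j * y t j k) t := by
      simpa using hasDerivAt_pi.1 (hasDerivAt_pi.1 (hy t) i) k
    simpa [hy0] using
      hconn.tendsto_consensus (x := fun t j => y t j k) hLap hpos hsum hleft hderiv i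
  exact ⟨tendsto_pi_nhds.2 fun i => tendsto_pi_nhds.2 fun k => hentry i k,
    fun i => hentry i i⟩
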